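/- Given positive definite forms f, g in R[x_1,...,x_n] with g nonconstant, there exists r_0 ≥ 0 such that for all r ≥ r_0, the form f·g^r lies in the interior of the sums-of-squares cone. -/

import Mathlib

open MvPolynomial Finsupp

/-- `f` is a sum of squares of forms of degree `d` in `n` variables. -/
def IsSOSForm (n d : ℕ) (f : MvPolynomial (Fin n) ℝ) : Prop :=
  ∃ (N : ℕ) (g : Fin N → MvPolynomial (Fin n) ℝ),
    (∀ i, (g i).IsHomogeneous d) ∧ f = ∑ i, (g i) ^ 2

/-- The cone `Σ_{2d}` of sums of squares of degree-`d` forms, as a subset of the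
finite-dimensional real vector space `R[x]_{2d}` of forms of degree `2d`. -/
def SigmaCone (n d : ℕ) : Set (homogeneousSubmodule (Fin n) ℝ (2 * d)) :=
  {f | IsSOSForm n d (f : MvPolynomial (Fin n) ℝ)}

/-- The canonical topology on the finite-dimensional real vector space of forms. -/
noncomputable instance (n d : ℕ) : TopologicalSpace (homogeneousSubmodule (Fin n) ℝ d) :=
  moduleTopology ℝ _

/-- A form is positive definite if it is positive away from the origin. -/
def PosDefForm (n : ℕ) (f : MvPolynomial (Fin n) ℝ) : Prop :=
  ∀ x : Fin n → ℝ, x ≠ 0 → 0 < eval x f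

/-- For a sos form `f` of degree `2d`, the set `U_f` of forms `p` of degree `d`
such that `f - c p ^ 2` is sos for some `c > 0`. -/
def Uset (n d : ℕ) (f : MvPolynomial (Fin n) ℝ) : Set (MvPolynomial (Fin n) ℝ) :=
  {p | p.IsHomogeneous d ∧ ∃ c : ℝ, 0 < c ∧ IsSOSForm n d (f - c • p ^ 2)}


section SOS

lemma sos_zero (n m : ℕ) : IsSOSForm n m 0 := ⟨0, fun _ => 0, by simp, by simp⟩

lemma sos_add {n m : ℕ} {p q : MvPolynomial (Fin n) ℝ} (hp : IsSOSForm n m p)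
    (hq : IsSOSForm n m q) : IsSOSForm n m (p + q) := by
  obtain ⟨N, a, ha, rfl⟩ := hp
  obtain ⟨K, b, hb, rfl⟩ := hq
  refine ⟨N + K, Fin.append a b, ?_, ?_⟩
  · intro i
    refine Fin.addCases (fun i => ?_) (fun i => ?_) i
    · simpa using ha i
    · simpa using hb i
  · simp [Fin.sum_univ_add]

lemma sos_sum {n m : ℕ} {ι : Type*} (s : Finset ι) (p : ι → MvPolynomial (Fin n) ℝ)
    (h : ∀ i ∈ s, IsSOSForm n m (p i)) : IsSOSForm n m (∑ i ∈ s, p i) :=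
  Finset.sum_induction p (IsSOSForm n m) (fun _ _ => sos_add) (sos_zero n m) h

lemma sos_smul {n m : ℕ} {c : ℝ} (hc : 0 ≤ c) {p : MvPolynomial (Fin n) ℝ}
    (hp : IsSOSForm n m p) : IsSOSForm n m (c • p) := by
  obtain ⟨N, a, ha, rfl⟩ := hp
  refine ⟨N, fun i => C (Real.sqrt c) * a i, fun i => (ha i).C_mul _, ?_⟩
  rw [Finset.smul_sum]
  refine Finset.sum_congr rfl fun i _ => ?_
  rw [mul_pow, ← C_pow, Real.sq_sqrt hc, smul_eq_C_mul]

lemma sos_sq {n m : ℕ} {p : MvPolynomial (Fin n) ℝ} (hp : p.IsHomogeneous m) :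
    IsSOSForm n m (p ^ 2) := ⟨1, fun _ => p, fun _ => hp, by simp⟩

lemma expand_hom {n m : ℕ} {Q : MvPolynomial (Fin n) ℝ} (hQ : Q.IsHomogeneous m) :
    (expand 2 Q).IsHomogeneous (2 * m) :=
  hQ.aeval (fun i => X i ^ 2) (fun i => by simpa using (isHomogeneous_X ℝ i).pow 2)

/-- exponents of a given degree -/
noncomputable def expSet (n m : ℕ) : Finset (Fin n →₀ ℕ) :=
  ((Finsupp.finite_of_degree_le m).subset
    (fun (x : Fin n →₀ ℕ) (hx : x ∈ {x : Fin n →₀ ℕ | x.degree = m}) => le_of_eq hx)).toFinset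

lemma mem_expSet {n m : ℕ} {a : Fin n →₀ ℕ} : a ∈ expSet n m ↔ a.degree = m := by
  simp [expSet]

lemma hom_as_sum {n m : ℕ} {p : MvPolynomial (Fin n) ℝ} (hp : p.IsHomogeneous m) :
    p = ∑ a ∈ expSet n m, monomial a (coeff a p) := by
  conv_lhs => rw [p.as_sum]
  refine Finset.sum_subset ?_ ?_
  · intro a ha
    rw [mem_expSet]
    by_contra h
    exact (MvPolynomial.mem_support_iff.1 ha) (hp.coeff_eq_zero h)
  · intro a _ ha
    rw [MvPolynomial.notMem_support_iff.1 ha, monomial_zero]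

lemma exp_split {n a b : ℕ} {γ : Fin n →₀ ℕ} (h : γ.degree = a + b) :
    ∃ α β : Fin n →₀ ℕ, α.degree = a ∧ β.degree = b ∧ γ = α + β := by
  obtain ⟨α, hα, hd⟩ := Finsupp.exists_le_degree_eq γ a (by omega)
  obtain ⟨β, rfl⟩ := le_iff_exists_add.mp hα
  refine ⟨α, β, hd, ?_, rfl⟩
  rw [map_add] at h
  omega

lemma monomial_one_sq {n : ℕ} (α : Fin n →₀ ℕ) :
    (monomial (2 • α) (1 : ℝ)) = (monomial α (1 : ℝ)) ^ 2 := by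
  rw [monomial_pow]; simp

lemma E_sos {n m : ℕ} (a b : Fin n →₀ ℕ) (ha : a.degree = m) (hb : b.degree = m)
    (t : ℝ) : IsSOSForm n m (|t| • (∑ α ∈ expSet n m, (monomial α (1 : ℝ)) ^ 2)
      + monomial (a + b) t) := by
  classical
  have hm : ∀ α ∈ expSet n m, (monomial α (1 : ℝ)).IsHomogeneous m := fun α hα =>
    isHomogeneous_monomial _ (mem_expSet.1 hα)
  have key : ∀ s : ℝ, s ^ 2 = 1 →
      IsSOSForm n m ((∑ α ∈ expSet n m, (monomial α (1 : ℝ)) ^ 2) + C s * (monomial a 1 * monomial b 1)) := by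
    intro s hs
    set E := ∑ α ∈ expSet n m, (monomial α (1 : ℝ)) ^ 2 with hE
    have h1 : ∀ c : Fin n →₀ ℕ, c.degree = m → IsSOSForm n m (E - monomial c 1 ^ 2) := by
      intro c hc
      rw [hE, ← Finset.add_sum_erase _ _ (mem_expSet.2 hc), add_sub_cancel_left]
      exact sos_sum _ _ fun i hi => sos_sq (hm i (Finset.mem_of_mem_erase hi))
    have h2 := sos_smul (c := 1/2) (by norm_num) (sos_add (sos_add (h1 a ha) (h1 b hb))
      (sos_sq ((hm a (mem_expSet.2 ha)).add ((hm b (mem_expSet.2 hb)).C_mul s))))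
    convert h2 using 1
    have hC : (C s : MvPolynomial (Fin n) ℝ) ^ 2 = 1 := by rw [← C_pow, hs, C_1]
    have h22 : (C (1/2) : MvPolynomial (Fin n) ℝ) * 2 = 1 := by
      rw [show (2 : MvPolynomial (Fin n) ℝ) = C 2 from (map_ofNat C 2).symm, ← C_mul]; norm_num
    rw [smul_eq_C_mul]
    linear_combination (-E - C s * (monomial a 1 * monomial b 1)) * h22 - C (1/2) * (monomial b 1)^2 * hC
  rcases le_total 0 t with ht | ht
  · convert sos_smul ht (key 1 (by norm_num)) using 1
    rw [abs_of_nonneg ht, smul_add, monomial_mul]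
    simp [smul_monomial]
  · convert sos_smul (neg_nonneg.2 ht) (key (-1) (by norm_num)) using 1
    rw [abs_of_nonpos ht, smul_add, monomial_mul]
    simp [smul_monomial]

end SOS

lemma interior_of_pos (n m : ℕ) (Q : MvPolynomial (Fin n) ℝ) (hQ : Q.IsHomogeneous m)
    (hpos : ∀ α : Fin n →₀ ℕ, α.degree = m → 0 < coeff α Q)
    (h : expand 2 Q ∈ homogeneousSubmodule (Fin n) ℝ (2 * m)) :
    (⟨expand 2 Q, h⟩ : homogeneousSubmodule (Fin n) ℝ (2 * m)) ∈ interior (SigmaCone n m) := by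
  classical
  have : IsModuleTopology ℝ (homogeneousSubmodule (Fin n) ℝ (2 * m)) := ⟨rfl⟩
  obtain ⟨c, hc, hcQ⟩ : ∃ c : ℝ, 0 < c ∧ ∀ α ∈ expSet n m, c ≤ coeff α Q := by
    rcases (expSet n m).eq_empty_or_nonempty with he | hne
    · exact ⟨1, one_pos, by simp [he]⟩
    · obtain ⟨a, ha, hmin⟩ := Finset.exists_min_image (expSet n m) (fun α => coeff α Q) hne
      exact ⟨coeff a Q, hpos a (mem_expSet.1 ha), hmin⟩
  have hcont : ∀ γ : Fin n →₀ ℕ, Continuous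
      (fun p : homogeneousSubmodule (Fin n) ℝ (2 * m) => coeff γ (p : MvPolynomial (Fin n) ℝ)) := by
    intro γ
    exact IsModuleTopology.continuous_of_linearMap
      ((lcoeff ℝ γ).comp (homogeneousSubmodule (Fin n) ℝ (2 * m)).subtype)
  let Nf : homogeneousSubmodule (Fin n) ℝ (2 * m) → ℝ := fun p =>
    ∑ γ ∈ expSet n (2 * m), |coeff γ (p : MvPolynomial (Fin n) ℝ) - coeff γ (expand 2 Q)|
  have hN : Continuous Nf := by
    refine continuous_finsetSum _ fun γ _ => ?_
    exact ((hcont γ).sub continuous_const).abs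
  rw [mem_interior]
  refine ⟨{p | Nf p < c}, ?_, isOpen_lt hN continuous_const, ?_⟩
  · intro p hp
    change IsSOSForm n m (p : MvPolynomial (Fin n) ℝ)
    have hp' : Nf p < c := hp
    have hph : (p : MvPolynomial (Fin n) ℝ).IsHomogeneous (2 * m) := p.2
    set E := ∑ α ∈ expSet n m, (monomial α (1 : ℝ)) ^ 2 with hE
    have hEs : IsSOSForm n m E := sos_sum _ _ fun i hi =>
      sos_sq (isHomogeneous_monomial _ (mem_expSet.1 hi))
    have hd := hom_as_sum (hph.sub (expand_hom hQ))
    have hQs : expand 2 Q = ∑ α ∈ expSet n m, coeff α Q • (monomial α (1 : ℝ)) ^ 2 := by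
      conv_lhs => rw [hom_as_sum hQ]
      rw [map_sum]
      refine Finset.sum_congr rfl fun α _ => ?_
      rw [expand_monomial, ← monomial_one_sq, smul_monomial]; simp
    have e : (p : MvPolynomial (Fin n) ℝ) =
        (∑ α ∈ expSet n m, (coeff α Q - c) • (monomial α (1 : ℝ)) ^ 2) + (c - Nf p) • E
        + ∑ γ ∈ expSet n (2 * m),
          (|coeff γ (p : MvPolynomial (Fin n) ℝ) - coeff γ (expand 2 Q)| • E
            + monomial γ (coeff γ (p : MvPolynomial (Fin n) ℝ) - coeff γ (expand 2 Q))) := by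
      rw [Finset.sum_add_distrib, ← Finset.sum_smul]
      simp only [coeff_sub] at hd
      rw [← hd]
      simp only [sub_smul, Finset.sum_sub_distrib, ← Finset.smul_sum]
      rw [← hQs, ← hE]
      simp only [Nf]
      abel
    rw [e]
    refine sos_add (sos_add (sos_sum _ _ fun α hα => sos_smul (sub_nonneg.2 (hcQ α hα)) (sos_sq (isHomogeneous_monomial _ (mem_expSet.1 hα)))) (sos_smul (by linarith) hEs)) (sos_sum _ _ fun γ hγ => ?_)
    obtain ⟨a, b, ha, hb, rfl⟩ := exp_split (a := m) (b := m) (by rw [mem_expSet.1 hγ]; ring)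
    exact E_sos a b ha hb _
  · simp [Nf, hc]

lemma exists_functional (n m : ℕ) (F I : homogeneousSubmodule (Fin n) ℝ (2 * m))
    (hF : F ∈ SigmaCone n m) (hI : I ∈ interior (SigmaCone n m))
    (hn : F ∉ interior (SigmaCone n m)) :
    ∃ Λ : MvPolynomial (Fin n) ℝ →ₗ[ℝ] ℝ,
      (∀ q : MvPolynomial (Fin n) ℝ, q.IsHomogeneous m → 0 ≤ Λ (q ^ 2)) ∧
      Λ (F : MvPolynomial (Fin n) ℝ) = 0 ∧ 0 < Λ (I : MvPolynomial (Fin n) ℝ) := by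
  have : IsModuleTopology ℝ (homogeneousSubmodule (Fin n) ℝ (2 * m)) := ⟨rfl⟩
  have : IsTopologicalAddGroup (homogeneousSubmodule (Fin n) ℝ (2 * m)) :=
    IsModuleTopology.topologicalAddGroup ℝ _
  have hconv : Convex ℝ (SigmaCone n m) := by
    intro x hx y hy a b ha hb _
    exact sos_add (sos_smul ha hx) (sos_smul hb hy)
  obtain ⟨L, hL⟩ := geometric_hahn_banach_open_point hconv.interior isOpen_interior hn
  have h0 : (0 : homogeneousSubmodule (Fin n) ℝ (2 * m)) ∈ SigmaCone n m := sos_zero n m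
  have hLI := hL I hI
  have hneg : ∀ s ∈ SigmaCone n m, L s ≤ 0 := by
    intro s hs
    by_contra hpos
    push Not at hpos
    set t : ℝ := (2 * |L F| + |L I|) / L s with ht
    have ht0 : 0 ≤ t := by positivity
    have h1 := hL _ (hconv.combo_self_interior_mem_interior (x := t • s) (y := I)
      (sos_smul ht0 hs) hI (a := 1/2) (b := 1/2) (by norm_num) (by norm_num) (by norm_num))
    simp only [map_add, map_smul, smul_eq_mul] at h1
    have h2 : t * L s = 2 * |L F| + |L I| := by rw [ht]; field_simp
    rw [h2] at h1
    have := le_abs_self (L F)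
    have := neg_abs_le (L I)
    linarith
  have hFn := hneg F hF
  have hF0 : L F = 0 := by
    by_contra hne
    have hlt : L F < 0 := lt_of_le_of_ne hFn hne
    have hLI0 : L I < 0 := hLI.trans hlt
    have hb : 0 < L F / L I := div_pos_of_neg_of_neg hlt hLI0
    have hb1 : L F / L I < 1 := by
      rw [div_lt_one_of_neg hLI0]; exact hLI
    have h1 := hL _ (hconv.combo_self_interior_mem_interior (x := 0) (y := I)
      h0 hI (a := 1 - L F / L I) (b := L F / L I) (by linarith) hb (by ring))
    simp only [map_add, map_smul, smul_eq_mul, map_zero, mul_zero, zero_add] at h1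
    rw [div_mul_cancel₀ _ hLI0.ne] at h1
    exact lt_irrefl _ h1
  let pr : MvPolynomial (Fin n) ℝ →ₗ[ℝ] homogeneousSubmodule (Fin n) ℝ (2 * m) :=
    (homogeneousComponent (2 * m)).codRestrict _ (fun p => homogeneousComponent_isHomogeneous _ p)
  have hpr : ∀ p : homogeneousSubmodule (Fin n) ℝ (2 * m), pr (p : MvPolynomial (Fin n) ℝ) = p := by
    intro p
    apply Subtype.ext
    exact homogeneousComponent_eq_self p.2
  refine ⟨-((L : homogeneousSubmodule (Fin n) ℝ (2 * m) →ₗ[ℝ] ℝ).comp pr), ?_, ?_, ?_⟩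
  · intro q hq
    have hq2 : (q ^ 2).IsHomogeneous (2 * m) := by
      have := hq.pow 2
      rwa [mul_comm] at this
    have h1 := hneg ⟨q ^ 2, hq2⟩ (sos_sq hq)
    have h2 := hpr ⟨q ^ 2, hq2⟩
    simp only at h2
    simp only [LinearMap.neg_apply, LinearMap.comp_apply, h2, ContinuousLinearMap.coe_coe]
    linarith
  · simp [hpr, hF0]
  · simp only [LinearMap.neg_apply, LinearMap.comp_apply, hpr, ContinuousLinearMap.coe_coe]
    linarith

lemma cs_zero {n m : ℕ} (Λ : MvPolynomial (Fin n) ℝ →ₗ[ℝ] ℝ)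
    (hΛ : ∀ q : MvPolynomial (Fin n) ℝ, q.IsHomogeneous m → 0 ≤ Λ (q ^ 2))
    {p q : MvPolynomial (Fin n) ℝ} (hp : p.IsHomogeneous m) (hq : q.IsHomogeneous m)
    (h0 : Λ (p ^ 2) = 0) : Λ (p * q) = 0 := by
  by_contra hne
  have h : ∀ t : ℝ, 0 ≤ 2 * t * Λ (p * q) + Λ (q ^ 2) := by
    intro t
    have h1 := hΛ (C t * p + q) ((hp.C_mul t).add hq)
    have h2 : (C t * p + q) ^ 2 = (t ^ 2) • p ^ 2 + (2 * t) • (p * q) + q ^ 2 := by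
      simp only [smul_eq_C_mul, C_pow, C_mul]
      rw [show (C 2 : MvPolynomial (Fin n) ℝ) = 2 from map_ofNat C 2]
      ring
    rw [h2] at h1
    simpa [h0] using h1
  have h1 := h (-(Λ (q ^ 2) + 1) / (2 * Λ (p * q)))
  have h2 : 2 * (-(Λ (q ^ 2) + 1) / (2 * Λ (p * q))) * Λ (p * q) = -(Λ (q ^ 2) + 1) := by
    field_simp
  linarith

/-- a functional vanishing on products of c with split factors vanishes on multiples of c. -/
lemma vanish_of_split {n a b : ℕ} (Λ : MvPolynomial (Fin n) ℝ →ₗ[ℝ] ℝ)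
    (c : MvPolynomial (Fin n) ℝ)
    (h : ∀ q q' : MvPolynomial (Fin n) ℝ, q.IsHomogeneous a → q'.IsHomogeneous b →
      Λ (c * q * q') = 0)
    {p : MvPolynomial (Fin n) ℝ} (hp : p.IsHomogeneous (a + b)) : Λ (c * p) = 0 := by
  rw [hom_as_sum hp, Finset.mul_sum, map_sum]
  refine Finset.sum_eq_zero fun γ hγ => ?_
  obtain ⟨α, β, hα, hβ, rfl⟩ := exp_split (mem_expSet.1 hγ)
  have := h (monomial α (coeff (α + β) p)) (monomial β 1) (isHomogeneous_monomial _ hα)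
    (isHomogeneous_monomial _ hβ)
  rwa [mul_assoc, monomial_mul, mul_one] at this

lemma descent {n d e M : ℕ} {f g : MvPolynomial (Fin n) ℝ} (hf : f.IsHomogeneous (2 * d))
    (hg : g.IsHomogeneous (2 * e)) (Λ : MvPolynomial (Fin n) ℝ →ₗ[ℝ] ℝ)
    (hΛ : ∀ q : MvPolynomial (Fin n) ℝ, q.IsHomogeneous M → 0 ≤ Λ (q ^ 2)) :
    ∀ J : ℕ, 1 ≤ J → (∀ j, 2 * j ≤ J + 1 → 2 * d + 2 * e * j ≤ M) →
      (∀ (a : ℕ) (p : MvPolynomial (Fin n) ℝ), 2 * d + 2 * e * J + a = 2 * M →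
        p.IsHomogeneous a → Λ (f * g ^ J * p) = 0) →
      ∀ (a : ℕ) (p : MvPolynomial (Fin n) ℝ), 2 * d + 2 * e + a = 2 * M →
        p.IsHomogeneous a → Λ (f * g * p) = 0 := by
  intro J
  induction J using Nat.strong_induction_on with
  | _ J ih =>
    intro hJ hdeg hD
    rcases hJ.eq_or_lt with rfl | hJ2
    · simpa using hD
    obtain ⟨j, hj⟩ : ∃ j, j = (J + 1) / 2 := ⟨_, rfl⟩
    refine ih j (by omega) (by omega) (fun i hi => hdeg i (by omega)) ?_
    intro a p ha hp
    have hle := hdeg j (by omega)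
    obtain ⟨b, hb⟩ := Nat.exists_eq_add_of_le hle
    obtain rfl : a = b + M := by omega
    refine vanish_of_split Λ _ ?_ hp
    intro q q' hq hq'
    have hh : (f * g ^ j * q).IsHomogeneous M := by
      rw [hb]; exact (hf.mul (hg.pow j)).mul hq
    refine cs_zero Λ hΛ hh hq' ?_
    obtain ⟨i, hi⟩ := Nat.exists_eq_add_of_le (show J ≤ 2 * j by omega)
    have e1 : (f * g ^ j * q) ^ 2 = f * g ^ J * (f * g ^ i * q ^ 2) := by
      have : g ^ (2 * j) = g ^ J * g ^ i := by rw [hi, pow_add]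
      rw [show 2 * j = j * 2 by ring, pow_mul] at this
      linear_combination f ^ 2 * q ^ 2 * this
    rw [e1]
    refine hD (2 * d + 2 * e * i + b * 2) _ ?_ ((hf.mul (hg.pow i)).mul (hq.pow 2))
    have : 2 * e * (2 * j) = 2 * e * J + 2 * e * i := by rw [hi]; ring
    have : 2 * e * (2 * j) = 2 * (2 * e * j) := by ring
    omega

lemma functional_kills {n d e s k : ℕ} {f g : MvPolynomial (Fin n) ℝ} (he : 1 ≤ e)
    (hf : f.IsHomogeneous (2 * d)) (hg : g.IsHomogeneous (2 * e))
    (Λ : MvPolynomial (Fin n) ℝ →ₗ[ℝ] ℝ)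
    (hΛ : ∀ q : MvPolynomial (Fin n) ℝ, q.IsHomogeneous (d + e * (s + 2 * k)) → 0 ≤ Λ (q ^ 2))
    (hs : IsSOSForm n (d + e * s) (f * g ^ s)) (hk : d + 1 ≤ k)
    (h0 : Λ (f * g ^ (s + 2 * k)) = 0)
    (a : ℕ) (p : MvPolynomial (Fin n) ℝ) (ha : 2 * d + 2 * e + a = 2 * (d + e * (s + 2 * k)))
    (hp : p.IsHomogeneous a) : Λ (f * g * p) = 0 := by
  obtain ⟨N, q, hq, hsum⟩ := hs
  refine descent hf hg Λ hΛ (s + k) (by omega) ?_ ?_ a p ha hp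
  · intro j hj
    have h1 : e * (2 * j) ≤ e * (s + k + 1) := Nat.mul_le_mul_left e hj
    have h2 : e * (d + 1) ≤ e * k := Nat.mul_le_mul_left e hk
    have h3 : 1 * d ≤ e * d := Nat.mul_le_mul_right d he
    nlinarith
  · intro b r hb hr
    have hqk : ∀ i, (q i * g ^ k).IsHomogeneous (d + e * (s + 2 * k)) := by
      intro i
      have := (hq i).mul (hg.pow k)
      convert this using 1; ring
    have hz : ∑ i, Λ ((q i * g ^ k) ^ 2) = 0 := by
      rw [← h0, ← map_sum]
      congr 1
      simp only [mul_pow]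
      rw [← Finset.sum_mul, ← hsum]; ring
    have hz' := (Finset.sum_eq_zero_iff_of_nonneg (fun i _ => hΛ _ (hqk i))).1 hz
    have e1 : f * g ^ (s + k) * r = ∑ i, (q i * g ^ k) * (q i * r) := by
      rw [pow_add, ← mul_assoc, hsum, Finset.sum_mul, Finset.sum_mul]
      exact Finset.sum_congr rfl fun i _ => by ring
    rw [e1, map_sum]
    refine Finset.sum_eq_zero fun i hi => cs_zero Λ hΛ (hqk i) ?_ (hz' i hi)
    convert (hq i).mul hr using 1
    nlinarith

open Topology in
lemma polya {n D : ℕ} (Q : MvPolynomial (Fin n) ℝ) (hQ : Q.IsHomogeneous D)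
    (hpos : ∀ y : Fin n → ℝ, (∀ i, 0 ≤ y i) → y ≠ 0 → 0 < eval y Q) :
    ∃ N₀ : ℕ, ∀ N, N₀ ≤ N → ∀ α : Fin n →₀ ℕ, α.degree = D + N →
      0 < coeff α (Q * (∑ i, X i) ^ N) := by
  classical
  let Φ : ℝ → (Fin n → ℝ) → ℝ := fun t y =>
    ∑ β ∈ Q.support, coeff β Q * ∏ i, ∏ j ∈ Finset.range (β i), (y i - j * t)
  have hΦc : Continuous (fun z : ℝ × (Fin n → ℝ) => Φ z.1 z.2) := by
    simp only [Φ]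
    fun_prop
  have hΦ0 : ∀ y, Φ 0 y = eval y Q := by
    intro y
    simp [Φ, eval_eq']
  have hev : ∀ᶠ t in 𝓝 (0 : ℝ), ∀ y ∈ stdSimplex ℝ (Fin n), 0 < Φ t y := by
    refine (isCompact_stdSimplex ℝ (Fin n)).eventually_forall_of_forall_eventually ?_
    intro y hy
    refine hΦc.continuousAt.eventually (lt_mem_nhds ?_)
    simp only
    rw [hΦ0]
    refine hpos y hy.1 ?_
    rintro rfl
    simpa using hy.2
  have hev2 := (tendsto_one_div_atTop_nhds_zero_nat (𝕜 := ℝ)).eventually hev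
  obtain ⟨N₁, hN₁⟩ := Filter.eventually_atTop.1 hev2
  refine ⟨N₁ + 1, fun N hN α hα => ?_⟩
  set M := D + N with hM
  have hMpos : (0 : ℝ) < M := by
    have : 0 < M := by omega
    exact_mod_cast this
  have hsum : ∑ i, (α i : ℝ) = M := by
    rw [← hα, Finsupp.degree_eq_sum]; push_cast; rfl
  have hpΦ : 0 < Φ (1 / (M : ℝ)) (fun i => α i / M) := by
    refine hN₁ M (by omega) _ ⟨fun i => by positivity, ?_⟩
    rw [← Finset.sum_div, hsum, div_self hMpos.ne']
  have key : ∀ β ∈ Q.support, (∏ i, ((α i).factorial : ℝ)) *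
      (if β ≤ α then coeff (α - β) ((∑ i, X i : MvPolynomial (Fin n) ℝ) ^ N) else 0) =
      (N.factorial : ℝ) * (M : ℝ) ^ D *
        ∏ i, ∏ j ∈ Finset.range (β i), ((α i : ℝ) / M - j * (1 / M)) := by
    intro β hβ
    have hβd : β.degree = D := by
      by_contra h
      exact (MvPolynomial.mem_support_iff.1 hβ) (hQ.coeff_eq_zero h)
    have h1 : (M : ℝ) ^ D * ∏ i, ∏ j ∈ Finset.range (β i), ((α i : ℝ) / M - j * (1 / M))
        = ∏ i, ((α i).descFactorial (β i) : ℝ) := by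
      rw [← hβd, Finsupp.degree_eq_sum, ← Finset.prod_pow_eq_pow_sum, ← Finset.prod_mul_distrib]
      refine Finset.prod_congr rfl fun i _ => ?_
      rw [← descPochhammer_eval_eq_descFactorial, descPochhammer_eval_eq_prod_range]
      conv_lhs => rw [← Finset.card_range (β i), ← Finset.prod_const]
      rw [Finset.card_range, ← Finset.prod_mul_distrib]
      refine Finset.prod_congr rfl fun j _ => ?_
      field_simp
    rw [mul_assoc, h1]
    split_ifs with hle
    · rw [coeff_sum_X_pow_of_fintype]
      have hs : (α - β).sum (fun _ m => m) = N := by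
        have h2 : (α - β).degree + β.degree = α.degree := by
          rw [← map_add, tsub_add_cancel_of_le hle]
        have h3 : (α - β).sum (fun _ m => m) = (α - β).degree := rfl
        omega
      rw [if_pos hs, Finsupp.multinomial_eq_of_support_subset (Finset.subset_univ _)]
      have hspec := Nat.multinomial_spec Finset.univ (⇑(α - β))
      have hs2 : ∑ i, (α - β) i = N := by
        rw [← hs, Finsupp.sum_fintype _ _ (fun _ => rfl)]
      rw [hs2] at hspec
      have h5 : ∀ i, (α i).factorial = ((α - β) i).factorial * (α i).descFactorial (β i) := by
        intro i
        rw [Finsupp.tsub_apply, Nat.factorial_mul_descFactorial (hle i)]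
      rw [← hspec]
      simp only [h5]
      push_cast
      rw [Finset.prod_mul_distrib]
      ring
    · obtain ⟨i, hi⟩ : ∃ i, α i < β i := by
        by_contra hcon
        push Not at hcon
        exact hle hcon
      have hz : ∏ i, ((α i).descFactorial (β i) : ℝ) = 0 :=
        Finset.prod_eq_zero (Finset.mem_univ i) (by rw [Nat.descFactorial_of_lt hi]; simp)
      rw [hz]; simp
  have hcoef : (∏ i, ((α i).factorial : ℝ)) * coeff α (Q * (∑ i, X i) ^ N) =
      (N.factorial : ℝ) * (M : ℝ) ^ D * Φ (1 / (M : ℝ)) (fun i => α i / M) := by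
    conv_lhs => rw [Q.as_sum]
    rw [Finset.sum_mul, coeff_sum, Finset.mul_sum]
    simp only [Φ, Finset.mul_sum]
    refine Finset.sum_congr rfl fun β hβ => ?_
    rw [coeff_monomial_mul']
    have := key β hβ
    have e : (if β ≤ α then coeff β Q * coeff (α - β) ((∑ i, X i : MvPolynomial (Fin n) ℝ) ^ N) else 0)
       = coeff β Q * (if β ≤ α then coeff (α - β) ((∑ i, X i : MvPolynomial (Fin n) ℝ) ^ N) else 0) := by
      split_ifs <;> simp
    rw [e]
    linear_combination coeff β Q * this
  have hp1 : 0 < (∏ i, ((α i).factorial : ℝ)) :=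
    Finset.prod_pos fun i _ => by exact_mod_cast Nat.factorial_pos _
  have hp2 : 0 < (N.factorial : ℝ) := by exact_mod_cast Nat.factorial_pos _
  have : 0 < (∏ i, ((α i).factorial : ℝ)) * coeff α (Q * (∑ i, X i) ^ N) := by
    rw [hcoef]; positivity
  exact pos_of_mul_pos_right this hp1.le

/-- sign change of variables -/
noncomputable def sgn {n : ℕ} (ε : Fin n → ℤˣ) :
    MvPolynomial (Fin n) ℝ →ₐ[ℝ] MvPolynomial (Fin n) ℝ :=
  aeval (fun i => C (((ε i : ℤ) : ℝ)) * X i)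

lemma sgn_monomial {n : ℕ} (ε : Fin n → ℤˣ) (α : Fin n →₀ ℕ) (c : ℝ) :
    sgn ε (monomial α c) = monomial α (c * ∏ i, ((ε i : ℤ) : ℝ) ^ α i) := by
  rw [sgn, aeval_monomial, Finsupp.prod_fintype _ _ (fun _ => by simp)]
  simp only [mul_pow]
  rw [Finset.prod_mul_distrib, monomial_eq (s := α), Finsupp.prod_fintype _ _ (fun _ => by simp)]
  simp only [algebraMap_eq, C_mul, map_prod, C_pow]
  ring

lemma coeff_sgn {n : ℕ} (ε : Fin n → ℤˣ) (α : Fin n →₀ ℕ) (p : MvPolynomial (Fin n) ℝ) :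
    coeff α (sgn ε p) = coeff α p * ∏ i, ((ε i : ℤ) : ℝ) ^ α i := by
  classical
  induction p using MvPolynomial.induction_on' with
  | monomial u a =>
    rw [sgn_monomial, coeff_monomial, coeff_monomial]
    split_ifs with h
    · rw [h]
    · simp
  | add p q hp hq => simp [hp, hq, add_mul]

lemma sgn_sgn {n : ℕ} (ε δ : Fin n → ℤˣ) (p : MvPolynomial (Fin n) ℝ) :
    sgn ε (sgn δ p) = sgn (δ * ε) p := by
  ext α
  simp only [coeff_sgn]
  rw [mul_assoc, ← Finset.prod_mul_distrib]
  congr 1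
  refine Finset.prod_congr rfl fun i _ => ?_
  simp [mul_pow]

lemma sgn_hom {n m : ℕ} (ε : Fin n → ℤˣ) {p : MvPolynomial (Fin n) ℝ} (hp : p.IsHomogeneous m) :
    (sgn ε p).IsHomogeneous m := by
  have := hp.aeval (fun i => C (((ε i : ℤ) : ℝ)) * X i)
    (fun i => isHomogeneous_C_mul_X (σ := Fin n) (((ε i : ℤ) : ℝ)) i)
  rwa [one_mul] at this

lemma eval_sgn {n : ℕ} (ε : Fin n → ℤˣ) (x : Fin n → ℝ) (p : MvPolynomial (Fin n) ℝ) :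
    eval x (sgn ε p) = eval (fun i => ((ε i : ℤ) : ℝ) * x i) p := by
  rw [sgn, ← coe_aeval_eq_eval, ← coe_aeval_eq_eval]
  simp only [RingHom.coe_coe]
  rw [← AlgHom.comp_apply, comp_aeval]
  simp

lemma exists_even {n D : ℕ} (P : MvPolynomial (Fin n) ℝ) (hP : P.IsHomogeneous (2 * D))
    (hpd : PosDefForm n P) :
    ∃ (K : ℕ) (h Q : MvPolynomial (Fin n) ℝ), h.IsHomogeneous (2 * K) ∧
      Q.IsHomogeneous (D + K) ∧ P * h = expand 2 Q ∧
      (∀ y : Fin n → ℝ, (∀ i, 0 ≤ y i) → y ≠ 0 → 0 < eval y Q) := by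
  classical
  set G := ∏ ε : Fin n → ℤˣ, sgn ε P with hG
  set h := ∏ ε ∈ Finset.univ.erase (1 : Fin n → ℤˣ), sgn ε P with hh
  have h1 : sgn (1 : Fin n → ℤˣ) P = P := by
    ext α; rw [coeff_sgn]; simp
  have hPh : P * h = G := by
    rw [hG, ← Finset.mul_prod_erase _ _ (Finset.mem_univ (1 : Fin n → ℤˣ)), h1]
  have hhh : h.IsHomogeneous (2 * ((Finset.univ.erase (1 : Fin n → ℤˣ)).card * D)) := by
    have := IsHomogeneous.prod (Finset.univ.erase (1 : Fin n → ℤˣ)) (fun ε => sgn ε P)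
      (fun _ => 2 * D) (fun ε _ => sgn_hom ε hP)
    rw [Finset.sum_const, smul_eq_mul] at this
    convert this using 1; ring
  set K := (Finset.univ.erase (1 : Fin n → ℤˣ)).card * D with hK
  have hGh : G.IsHomogeneous (2 * (D + K)) := by
    rw [← hPh, mul_add]; exact hP.mul hhh
  have hinv : ∀ δ : Fin n → ℤˣ, sgn δ G = G := by
    intro δ
    rw [hG, map_prod]
    simp only [sgn_sgn]
    exact Fintype.prod_equiv (Equiv.mulRight δ) _ _ (fun ε => rfl)
  have heven : ∀ α ∈ G.support, ∀ i, 2 ∣ α i := by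
    intro α hα i
    by_contra hodd
    have hodd' : Odd (α i) := by
      rw [← Nat.not_even_iff_odd, even_iff_two_dvd]; exact hodd
    have h2 := congrArg (coeff α) (hinv (Pi.mulSingle i (-1)))
    rw [coeff_sgn] at h2
    have h3 : ∏ j, (((Pi.mulSingle i (-1 : ℤˣ) : Fin n → ℤˣ) j : ℤ) : ℝ) ^ α j = -1 := by
      rw [Finset.prod_eq_single i]
      · simp [hodd'.neg_one_pow]
      · intro j _ hj
        simp [Pi.mulSingle_eq_of_ne hj]
      · simp
    rw [h3] at h2
    have := MvPolynomial.mem_support_iff.1 hα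
    apply this
    linarith
  let hf : (Fin n →₀ ℕ) → (Fin n →₀ ℕ) := fun α => α.mapRange (fun k => k / 2) (by simp)
  have hhf : ∀ α ∈ G.support, 2 • hf α = α := by
    intro α hα
    ext i
    simp only [hf, Finsupp.smul_apply, Finsupp.mapRange_apply, smul_eq_mul]
    exact Nat.mul_div_cancel' (heven α hα i)
  let Q := ∑ α ∈ G.support, monomial (hf α) (coeff α G)
  have hQG : expand 2 Q = G := by
    conv_rhs => rw [G.as_sum]
    simp only [Q, map_sum]
    refine Finset.sum_congr rfl fun α hα => ?_
    rw [expand_monomial, hhf α hα]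
  refine ⟨K, h, Q, hhh, ?_, by rw [hPh, hQG], ?_⟩
  · refine IsHomogeneous.sum _ _ _ fun α hα => isHomogeneous_monomial _ ?_
    have h2 : α.degree = 2 * (D + K) := by
      by_contra hne
      exact (MvPolynomial.mem_support_iff.1 hα) (hGh.coeff_eq_zero hne)
    rw [← hhf α hα, map_nsmul, smul_eq_mul] at h2
    omega
  · intro y hy hy0
    have h2 : (fun i => Real.sqrt (y i)) ^ 2 = y := by
      ext i; simp [Real.sq_sqrt (hy i)]
    have h3 : eval y Q = eval (fun i => Real.sqrt (y i)) G := by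
      rw [← hQG, eval_expand, h2]
    rw [h3, hG, map_prod]
    refine Finset.prod_pos fun ε _ => ?_
    rw [eval_sgn]
    refine hpd _ ?_
    intro hz
    apply hy0
    ext i
    have h4 := congrFun hz i
    simp only [Pi.zero_apply, mul_eq_zero] at h4
    rcases h4 with h4 | h4
    · exact absurd h4 (by exact_mod_cast (ε i).ne_zero)
    · exact (Real.sqrt_eq_zero (hy i)).1 h4

theorem main_result (n d e : ℕ) (f g : MvPolynomial (Fin n) ℝ)
    (hf : f.IsHomogeneous (2 * d)) (hg : g.IsHomogeneous (2 * e))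
    (hfpd : PosDefForm n f) (hgpd : PosDefForm n g)
    (hgnc : ¬ ∃ a : ℝ, g = C a)
    (hmem : ∀ r : ℕ, f * g ^ r ∈ homogeneousSubmodule (Fin n) ℝ (2 * (d + e * r)))
    (hReznick : ∃ r₁ : ℕ, ∀ r : ℕ, r₁ ≤ r → IsSOSForm n (d + e * r) (f * g ^ r)) :
    ∃ r₀ : ℕ, ∀ r : ℕ, r₀ ≤ r →
      (⟨f * g ^ r, hmem r⟩ : homogeneousSubmodule (Fin n) ℝ (2 * (d + e * r)))
        ∈ interior (SigmaCone n (d + e * r)) := by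
  have he : 1 ≤ e := by
    by_contra hcon
    obtain rfl : e = 0 := by omega
    have h0 := (totalDegree_zero_iff_isHomogeneous (Fin n)).2 hg
    exact hgnc ⟨_, totalDegree_eq_zero_iff_eq_C.1 h0⟩
  obtain ⟨r₁, hr₁⟩ := hReznick
  have hP : (f * g).IsHomogeneous (2 * (d + e)) := by
    rw [mul_add]; exact hf.mul hg
  have hPpd : PosDefForm n (f * g) := by
    intro x hx
    rw [map_mul]
    exact mul_pos (hfpd x hx) (hgpd x hx)
  obtain ⟨K, h, Q, hh, hQ, hPh, hQpos⟩ := exists_even (f * g) hP hPpd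
  obtain ⟨N₀, hN₀⟩ := polya Q hQ hQpos
  refine ⟨r₁ + 2 * (d + 1) + 1 + (d + e + K + N₀), fun r hr => ?_⟩
  obtain ⟨s, k, hs, hk, rfl⟩ : ∃ s k, r₁ ≤ s ∧ d + 1 ≤ k ∧ r = s + 2 * k := by
    refine ⟨r₁ + (r - r₁) % 2, (r - r₁) / 2, ?_, ?_, ?_⟩ <;> omega
  have hbig : d + e + K + N₀ ≤ d + e * (s + 2 * k) := by
    have := Nat.mul_le_mul_right (s + 2 * k) he
    omega
  obtain ⟨b, hb⟩ := Nat.exists_eq_add_of_le hbig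
  have hS : (∑ i, X i : MvPolynomial (Fin n) ℝ).IsHomogeneous 1 :=
    IsHomogeneous.sum _ _ _ fun i _ => isHomogeneous_X ℝ i
  have hQS : (Q * (∑ i, X i) ^ (N₀ + b)).IsHomogeneous (d + e * (s + 2 * k)) := by
    have := hQ.mul (hS.pow (N₀ + b))
    convert this using 1
    omega
  have hIint := interior_of_pos n _ _ hQS
    (fun α hα => hN₀ (N₀ + b) (by omega) α (by omega)) (expand_hom hQS)
  by_contra hn
  obtain ⟨Λ, hΛ, hΛF, hΛI⟩ := exists_functional n _ _ _ (hr₁ _ (by omega)) hIint hn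
  refine hΛI.ne' ?_
  have e1 : expand 2 (Q * (∑ i, X i) ^ (N₀ + b)) =
      f * g * (h * expand 2 ((∑ i, X i) ^ (N₀ + b))) := by
    rw [map_mul, ← hPh, mul_assoc]
  simp only
  rw [e1]
  refine functional_kills he hf hg Λ hΛ (hr₁ s hs) hk hΛF (2 * K + 2 * (1 * (N₀ + b))) _ ?_
    (hh.mul (expand_hom (hS.pow _)))
  omega
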